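/- For all z, u ∈ ℂ with z, u, z+u, z−u outside the lattice Λ: φ(z,u)·φ(z,−u) = E₂(z) − E₂(u), and consequently φ(z,u)·φ(z,−u) = ℘(z) − ℘(u). -/

import Mathlib

open Complex Matrix Kronecker Finset Filter Topology

noncomputable section

/-- The lattice Λ = ℤ + τℤ. -/
def Lam (τ : ℂ) : Set ℂ := {z : ℂ | ∃ m n : ℤ, z = (m : ℂ) + (n : ℂ) * τ}

/-- The first Jacobi theta function
ϑ(z) = −∑_{j∈ℤ} exp(πi(j+1/2)²τ + 2πi(j+1/2)(z+1/2)). -/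
def theta (τ : ℂ) (z : ℂ) : ℂ :=
  -∑' j : ℤ, Complex.exp ((Real.pi : ℂ) * Complex.I * ((j : ℂ) + 1 / 2) ^ 2 * τ +
      2 * (Real.pi : ℂ) * Complex.I * ((j : ℂ) + 1 / 2) * (z + 1 / 2))

/-- The first Eisenstein function E₁(u) = ϑ′(u)/ϑ(u). -/
def E1 (τ : ℂ) (u : ℂ) : ℂ := deriv (theta τ) u / theta τ u

/-- The Kronecker function φ(z,u) = ϑ′(0)·ϑ(z+u)/(ϑ(z)·ϑ(u)). -/
def phi (τ : ℂ) (z u : ℂ) : ℂ :=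
  deriv (theta τ) 0 * theta τ (z + u) / (theta τ z * theta τ u)

/-- The second Eisenstein function E₂(u) = −E₁′(u). -/
def E2 (τ : ℂ) (u : ℂ) : ℂ := -deriv (E1 τ) u

/-- The Weierstrass ℘-function: ℘(u) = E₂(u) + (1/3)·ϑ‴(0)/ϑ′(0). -/
def wp (τ : ℂ) (u : ℂ) : ℂ :=
  E2 τ u + (1 / 3) * iteratedDeriv 3 (theta τ) 0 / deriv (theta τ) 0

lemma theta_eq (τ z : ℂ) : theta τ z =
    -(cexp (Real.pi * I * τ / 4 + Real.pi * I * (z + 1 / 2)) *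
      jacobiTheta₂ (z + (1 / 2 + τ / 2)) τ) := by
  unfold theta jacobiTheta₂
  rw [← tsum_mul_left]
  congr 1
  refine tsum_congr fun j => ?_
  rw [jacobiTheta₂_term, ← Complex.exp_add]
  congr 1
  ring

lemma theta_diff (τ : ℂ) (hτ : 0 < τ.im) : Differentiable ℂ (theta τ) := by
  have h : theta τ = fun z => -(cexp (Real.pi * I * τ / 4 + Real.pi * I * (z + 1 / 2)) *
      jacobiTheta₂ (z + (1 / 2 + τ / 2)) τ) := funext (theta_eq τ)
  rw [h]
  intro z
  have := (differentiableAt_jacobiTheta₂_fst (z + (1 / 2 + τ / 2)) hτ).comp z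
    (f := fun z : ℂ => z + (1 / 2 + τ / 2)) (by fun_prop)
  have h2 : DifferentiableAt ℂ (fun z : ℂ => jacobiTheta₂ (z + (1 / 2 + τ / 2)) τ) z := this
  fun_prop

lemma theta_add_one (τ z : ℂ) : theta τ (z + 1) = -theta τ z := by
  rw [theta_eq, theta_eq, add_right_comm z 1 (1 / 2 + τ / 2), jacobiTheta₂_add_left]
  have : (Real.pi * I * τ / 4 + Real.pi * I * (z + 1 + 1 / 2) : ℂ) =
    (Real.pi * I * τ / 4 + Real.pi * I * (z + 1 / 2)) + Real.pi * I := by ring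
  rw [this, Complex.exp_add, Complex.exp_pi_mul_I]
  ring

lemma theta_add_tau (τ z : ℂ) :
    theta τ (z + τ) = -cexp (-Real.pi * I * (τ + 2 * z)) * theta τ z := by
  rw [theta_eq, theta_eq, add_right_comm z τ (1 / 2 + τ / 2), jacobiTheta₂_add_left']
  have h : cexp (Real.pi * I * τ / 4 + Real.pi * I * (z + τ + 1 / 2)) *
      cexp (-Real.pi * I * (τ + 2 * (z + (1 / 2 + τ / 2)))) =
      -cexp (-Real.pi * I * (τ + 2 * z)) *
        cexp (Real.pi * I * τ / 4 + Real.pi * I * (z + 1 / 2)) := by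
    rw [neg_mul (cexp _), ← Complex.exp_add, ← Complex.exp_add]
    have : (Real.pi * I * τ / 4 + Real.pi * I * (z + τ + 1 / 2) +
       -Real.pi * I * (τ + 2 * (z + (1 / 2 + τ / 2))) : ℂ) =
       (-Real.pi * I * (τ + 2 * z) + (Real.pi * I * τ / 4 + Real.pi * I * (z + 1 / 2)))
        - Real.pi * I := by ring
    rw [this, Complex.exp_sub, Complex.exp_pi_mul_I]
    ring
  linear_combination (-jacobiTheta₂ (z + (1 / 2 + τ / 2)) τ) * h

lemma theta_neg (τ z : ℂ) : theta τ (-z) = -theta τ z := by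
  rw [theta_eq, theta_eq]
  have h1 : jacobiTheta₂ (-z + (1 / 2 + τ / 2)) τ =
      -(cexp (Real.pi * I * (2 * z)) * jacobiTheta₂ (z + (1 / 2 + τ / 2)) τ) := by
    have e : z + (1 / 2 + τ / 2) = (z - (1 / 2 + τ / 2) + 1) + τ := by ring
    rw [← jacobiTheta₂_neg_left, e, jacobiTheta₂_add_left', jacobiTheta₂_add_left,
      ← mul_assoc, ← Complex.exp_add]
    have e2 : (Real.pi * I * (2 * z) + -Real.pi * I * (τ + 2 * (z - (1 / 2 + τ / 2) + 1)) : ℂ)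
      = -(Real.pi * I)  := by ring
    have e3 : -(-z + (1 / 2 + τ / 2)) = z - (1/2 + τ/2) := by ring
    rw [e2, e3, Complex.exp_neg, Complex.exp_pi_mul_I]
    norm_num
  have h2 : cexp (Real.pi * I * τ / 4 + Real.pi * I * (z + 1 / 2)) =
      cexp (Real.pi * I * τ / 4 + Real.pi * I * (-z + 1 / 2)) * cexp (Real.pi * I * (2 * z)) := by
    rw [← Complex.exp_add]; congr 1; ring
  rw [h1, h2]
  ring

lemma jt_mul (τ : ℂ) (hτ : 0 < τ.im) (x y : ℂ) :
    jacobiTheta₂ x τ * jacobiTheta₂ y τ =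
      jacobiTheta₂ (x + y) (2 * τ) * jacobiTheta₂ (x - y) (2 * τ) +
      cexp (2 * Real.pi * I * x + Real.pi * I * τ) *
        (jacobiTheta₂ (x + y + τ) (2 * τ) * jacobiTheta₂ (x - y + τ) (2 * τ)) := by
  have h2 : 0 < (2 * τ).im := by simpa using hτ
  have S : ∀ (σ : ℂ), 0 < σ.im → ∀ x, Summable (fun n => ‖jacobiTheta₂_term n x σ‖) :=
    fun σ hσ x => ((summable_jacobiTheta₂_term_iff x σ).2 hσ).norm
  unfold jacobiTheta₂
  rw [tsum_mul_tsum_of_summable_norm (S _ hτ _) (S _ hτ _),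
    tsum_mul_tsum_of_summable_norm (S _ h2 _) (S _ h2 _),
    tsum_mul_tsum_of_summable_norm (S _ h2 _) (S _ h2 _), ← tsum_mul_left]
  let g : (ℤ × ℤ) ⊕ (ℤ × ℤ) → ℤ × ℤ :=
    Sum.elim (fun p => (p.1 + p.2, p.1 - p.2)) (fun p => (p.1 + p.2 + 1, p.1 - p.2))
  have hg : Function.Bijective g := by
    constructor
    · rintro (⟨a, b⟩ | ⟨a, b⟩) (⟨c, d⟩ | ⟨c, d⟩) h <;> simp [g] at h ⊢ <;> omega
    · rintro ⟨j, k⟩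
      rcases Int.even_or_odd' (j + k) with ⟨p, hp | hp⟩
      · exact ⟨Sum.inl (p, j - p), by simp [g]; omega⟩
      · exact ⟨Sum.inr (p, j - p - 1), by simp [g]; omega⟩
  rw [← (Equiv.ofBijective g hg).tsum_eq, Summable.tsum_sum]
  · congr 1
    · refine tsum_congr fun p => ?_
      simp only [g, Equiv.ofBijective_apply, Sum.elim_inl, jacobiTheta₂_term, ← Complex.exp_add]
      congr 1; push_cast; ring
    · refine tsum_congr fun p => ?_
      simp only [g, Equiv.ofBijective_apply, Sum.elim_inr, jacobiTheta₂_term, ← Complex.exp_add]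
      congr 1; push_cast; ring
  all_goals
    have := summable_mul_of_summable_norm (S _ hτ x) (S _ hτ y)
    have h3 := (Equiv.ofBijective g hg).summable_iff.2 this
  · exact h3.comp_injective Sum.inl_injective
  · exact h3.comp_injective Sum.inr_injective

def ta (τ z : ℂ) : ℂ := jacobiTheta₂ (2 * z) (2 * τ)
def tb (τ z : ℂ) : ℂ :=
  cexp (Real.pi * I * τ / 2 + 2 * Real.pi * I * z) * jacobiTheta₂ (2 * z + τ) (2 * τ)

lemma theta_add_mul (τ : ℂ) (hτ : 0 < τ.im) (z u : ℂ) :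
    theta τ (z + u) * theta τ (z - u) = ta τ z * tb τ u - tb τ z * ta τ u := by
  rw [theta_eq, theta_eq, neg_mul_neg, mul_mul_mul_comm, jt_mul τ hτ]
  have e1 : z + u + (1 / 2 + τ / 2) + (z - u + (1 / 2 + τ / 2)) = 2 * z + τ + 1 := by ring
  have e2 : z + u + (1 / 2 + τ / 2) - (z - u + (1 / 2 + τ / 2)) = 2 * u := by ring
  have e3 : 2 * z + τ + 1 + τ = 2 * z + 2 * τ + 1 := by ring
  rw [e1, e2, e3, jacobiTheta₂_add_left, jacobiTheta₂_add_left, jacobiTheta₂_add_left']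
  unfold ta tb
  have k1 : cexp (Real.pi * I * τ / 4 + Real.pi * I * (z + u + 1 / 2)) *
      cexp (Real.pi * I * τ / 4 + Real.pi * I * (z - u + 1 / 2)) =
      - cexp (Real.pi * I * τ / 2 + 2 * Real.pi * I * z) := by
    rw [← Complex.exp_add]
    have : (Real.pi * I * τ / 4 + Real.pi * I * (z + u + 1 / 2) +
      (Real.pi * I * τ / 4 + Real.pi * I * (z - u + 1 / 2)) : ℂ) =
      Real.pi * I * τ / 2 + 2 * Real.pi * I * z + Real.pi * I := by ring
    rw [this, Complex.exp_add, Complex.exp_pi_mul_I]; ring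
  have k2 : cexp (Real.pi * I * τ / 2 + 2 * Real.pi * I * z) *
      (cexp (2 * Real.pi * I * (z + u + (1 / 2 + τ / 2)) + Real.pi * I * τ) *
      cexp (-Real.pi * I * (2 * τ + 2 * (2 * z)))) =
      - cexp (Real.pi * I * τ / 2 + 2 * Real.pi * I * u) := by
    rw [← Complex.exp_add, ← Complex.exp_add]
    have : (Real.pi * I * τ / 2 + 2 * Real.pi * I * z +
      (2 * Real.pi * I * (z + u + (1 / 2 + τ / 2)) + Real.pi * I * τ +
      -Real.pi * I * (2 * τ + 2 * (2 * z))) : ℂ) =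
      Real.pi * I * τ / 2 + 2 * Real.pi * I * u + Real.pi * I := by ring
    rw [this, Complex.exp_add, Complex.exp_pi_mul_I]; ring
  rw [k1]
  linear_combination (-jacobiTheta₂ (2 * z) (2 * τ) * jacobiTheta₂ (2 * u + τ) (2 * τ)) * k2

lemma jt_ne_zero (τ : ℂ) (hτ : 0 < τ.im) : ∃ x : ℂ, jacobiTheta₂ x τ ≠ 0 := by
  by_contra! hc
  have H := intervalIntegral.hasSum_integral_of_dominated_convergence
    (μ := MeasureTheory.volume) (a := 0) (b := 1)
    (F := fun (n : ℤ) (x : ℝ) => jacobiTheta₂_term n x τ) (f := fun _ => 0)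
    (fun n _ => ‖jacobiTheta₂_term n 0 τ‖)
    (fun n => by unfold jacobiTheta₂_term; exact (by fun_prop : Continuous _).aestronglyMeasurable)
    (fun n => Eventually.of_forall fun x _ => by simp [norm_jacobiTheta₂_term])
    (Eventually.of_forall fun x _ => ((summable_jacobiTheta₂_term_iff 0 τ).2 hτ).norm)
    (by simp)
    (Eventually.of_forall fun x _ => by
      have := hasSum_jacobiTheta₂_term (x : ℂ) hτ
      rwa [hc] at this)
  have h0 : ∀ n : ℤ, n ≠ 0 → ∫ x in (0:ℝ)..1, jacobiTheta₂_term n x τ = 0 := by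
    intro n hn
    have hp : (2 * Real.pi * I * n : ℂ) ≠ 0 := by
      simp [hn, Real.pi_ne_zero]
    simp only [jacobiTheta₂_term, Complex.exp_add]
    rw [intervalIntegral.integral_mul_const, integral_exp_mul_complex hp]
    have : (2 * Real.pi * I * n * (1:ℝ) : ℂ) = n * (2 * Real.pi * I) := by push_cast; ring
    rw [this, Complex.exp_int_mul_two_pi_mul_I]
    simp
  have H2 := hasSum_single (f := fun n : ℤ => ∫ x in (0:ℝ)..1, jacobiTheta₂_term n x τ) 0
    (fun n hn => h0 n hn)
  have := H.unique H2
  simp [jacobiTheta₂_term] at this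

lemma theta_ne_zero (τ : ℂ) (hτ : 0 < τ.im) : ∃ x : ℂ, theta τ x ≠ 0 := by
  obtain ⟨x, hx⟩ := jt_ne_zero τ hτ
  refine ⟨x - (1 / 2 + τ / 2), ?_⟩
  rw [theta_eq, sub_add_cancel]
  simp [hx, Complex.exp_ne_zero]

lemma entire_mul_zero {f g : ℂ → ℂ} (hf : Differentiable ℂ f) (hg : Differentiable ℂ g)
    (h : ∀ z, f z * g z = 0) (hne : ∃ z, g z ≠ 0) : ∀ z, f z = 0 := by
  have := AnalyticOnNhd.eq_zero_or_eq_zero_of_mul_eq_zero (U := Set.univ)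
    (fun z _ => hf.analyticAt z) (fun z _ => hg.analyticAt z) (fun z _ => h z)
    isPreconnected_univ
  rcases this with h1 | h1
  · exact fun z => h1 z trivial
  · obtain ⟨z, hz⟩ := hne
    exact absurd (h1 z trivial) hz

lemma entire_order_ne_top {f : ℂ → ℂ} (hf : Differentiable ℂ f) (hne : ∃ z, f z ≠ 0) (z : ℂ) :
    analyticOrderAt f z ≠ ⊤ := by
  obtain ⟨x, hx⟩ := hne
  have hF : AnalyticOnNhd ℂ f Set.univ := fun z _ => hf.analyticAt z
  refine AnalyticOnNhd.analyticOrderAt_ne_top_of_isPreconnected hF isPreconnected_univ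
    (Set.mem_univ x) (Set.mem_univ z) ?_
  rw [((hf.analyticAt x).analyticOrderAt_eq_zero).2 hx]
  simp

lemma entire_quot {f g : ℂ → ℂ} (hf : Differentiable ℂ f) (hg : Differentiable ℂ g)
    (hne : ∃ z, g z ≠ 0) (h : ∀ z, analyticOrderAt f z = analyticOrderAt g z) :
    ∃ q : ℂ → ℂ, Differentiable ℂ q ∧ (∀ z, q z ≠ 0) ∧ ∀ z, f z = q z * g z := by
  have hm : MeromorphicOn (f / g) Set.univ := fun z _ =>
    (hf.analyticAt z).meromorphicAt.div (hg.analyticAt z).meromorphicAt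
  have hord : ∀ z, meromorphicOrderAt (f / g) z = 0 := by
    intro z
    rw [meromorphicOrderAt_div (hf.analyticAt z).meromorphicAt (hg.analyticAt z).meromorphicAt,
      (hf.analyticAt z).meromorphicOrderAt_eq, (hg.analyticAt z).meromorphicOrderAt_eq, h z]
    have := entire_order_ne_top hg hne z
    lift analyticOrderAt g z to ℕ using this with n
    simp only [ENat.map_natCast]
    norm_cast
    simp
  have hNF := meromorphicNFOn_toMeromorphicNFOn (f / g) Set.univ
  have hord' : ∀ z, meromorphicOrderAt (toMeromorphicNFOn (f / g) Set.univ) z = 0 := fun z => by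
    rw [meromorphicOrderAt_toMeromorphicNFOn hm (Set.mem_univ z), hord]
  have hqd : ∀ z, AnalyticAt ℂ (toMeromorphicNFOn (f / g) Set.univ) z := fun z =>
    (hNF (Set.mem_univ z)).meromorphicOrderAt_nonneg_iff_analyticAt.1 (hord' z).ge
  refine ⟨toMeromorphicNFOn (f / g) Set.univ, fun z => (hqd z).differentiableAt,
    fun z => (hNF (Set.mem_univ z)).meromorphicOrderAt_eq_zero_iff.1 (hord' z), ?_⟩
  intro z
  have e1 := hm.toMeromorphicNFOn_eq_self_on_nhdsNE (Set.mem_univ z)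
  have e2 : ∀ᶠ x in 𝓝[≠] z, g x ≠ 0 := by
    rcases (hg.analyticAt z).eventually_eq_zero_or_eventually_ne_zero with h0 | h0
    · exact absurd (analyticOrderAt_eq_top.2 h0) (entire_order_ne_top hg hne z)
    · exact h0
  have e3 : f =ᶠ[𝓝[≠] z] fun x => toMeromorphicNFOn (f / g) Set.univ x * g x := by
    filter_upwards [e1, e2] with x h1 h2
    rw [h1, Pi.div_apply, div_mul_cancel₀ _ h2]
  have e4 : f =ᶠ[𝓝 z] fun x => toMeromorphicNFOn (f / g) Set.univ x * g x :=
    ((hf z).continuousAt.eventuallyEq_nhds_iff_eventuallyEq_nhdsNE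
      ((hqd z).continuousAt.mul (hg z).continuousAt)).1 e3
  exact e4.eq_of_nhds

lemma int_seq_const (r : ℤ → ℕ) (h : ∀ n, r (n + 1) + r (n - 1) = 2 * r n) (n : ℤ) :
    r (n + 1) = r n := by
  have key : ∀ k : ℕ, (r (n + k) : ℤ) = r n + k * ((r (n + 1) : ℤ) - r n) ∧
      (r (n + k + 1) : ℤ) = r n + (k + 1) * ((r (n + 1) : ℤ) - r n) := by
    intro k
    induction k with
    | zero => simp
    | succ k ih =>
      have := h (n + k + 1)
      rw [add_sub_cancel_right] at this
      push_cast
      rw [← add_assoc]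
      refine ⟨ih.2, ?_⟩
      zify at this
      linarith [ih.1, ih.2]
  have key2 : ∀ k : ℕ, (r (n - k) : ℤ) = r n - k * ((r (n + 1) : ℤ) - r n) ∧
      (r (n - k + 1) : ℤ) = r n - (k - 1) * ((r (n + 1) : ℤ) - r n) := by
    intro k
    induction k with
    | zero => simp
    | succ k ih =>
      have := h (n - k)
      push_cast
      have e : n - ((k : ℤ) + 1) + 1 = n - k := by ring
      have e' : n - ((k : ℤ) + 1) = n - k - 1 := by ring
      rw [e, e']
      zify at this
      refine ⟨by linarith [ih.1, ih.2], by linarith [ih.1, ih.2]⟩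
  have a1 := (key (r n + 1)).1
  have a2 := (key2 (r n + 1)).1
  have p1 : (0:ℤ) ≤ r (n + (r n + 1 : ℕ)) := by positivity
  have p2 : (0:ℤ) ≤ r (n - (r n + 1 : ℕ)) := by positivity
  rw [a1] at p1
  rw [a2] at p2
  push_cast at p1 p2
  have : (r (n+1) : ℤ) - r n = 0 := by
    rcases lt_trichotomy ((r (n+1) : ℤ) - r n) 0 with hd | hd | hd
    · nlinarith
    · exact hd
    · nlinarith
  omega

lemma elliptic_const (τ : ℂ) (hτ : 0 < τ.im) {p : ℂ → ℂ} (hp : Differentiable ℂ p)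
    (h1 : ∀ z, p (z + 1) = p z) (h2 : ∀ z, p (z + τ) = p z) : ∃ c, ∀ z, p z = c := by
  have P1 : ∀ (m : ℤ) z, p (z + m) = p z := fun m z => by
    have : Function.Periodic p 1 := h1
    simpa using this.int_mul m z
  have P2 : ∀ (m : ℤ) z, p (z + m * τ) = p z := fun m z => by
    have : Function.Periodic p τ := h2
    simpa using this.int_mul m z
  have hK : IsCompact ((fun x : ℝ × ℝ => p (x.1 + x.2 * τ)) '' (Set.Icc 0 1 ×ˢ Set.Icc 0 1)) := by
    apply (isCompact_Icc.prod isCompact_Icc).image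
    exact hp.continuous.comp (by fun_prop)
  have hb : Bornology.IsBounded (Set.range p) := by
    refine hK.isBounded.subset ?_
    rintro _ ⟨z, rfl⟩
    set s := z.im / τ.im with hs
    set r := z.re - s * τ.re with hr
    have hz : z = r + s * τ := by
      apply Complex.ext
      · simp [hr]
      · simp [hs, hτ.ne']
    refine ⟨(Int.fract r, Int.fract s), ⟨⟨Int.fract_nonneg _, (Int.fract_lt_one _).le⟩,
      ⟨Int.fract_nonneg _, (Int.fract_lt_one _).le⟩⟩, ?_⟩
    simp only
    rw [← P1 ⌊r⌋, ← P2 ⌊s⌋]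
    congr 1
    rw [hz]
    have e1 : ((Int.fract r : ℝ) : ℂ) + (⌊r⌋ : ℂ) = r := by
      exact_mod_cast Int.fract_add_floor r
    have e2 : ((Int.fract s : ℝ) : ℂ) + (⌊s⌋ : ℂ) = s := by
      exact_mod_cast Int.fract_add_floor s
    linear_combination e1 + τ * e2
  obtain ⟨c, hc⟩ := hp.exists_eq_const_of_bounded hb
  exact ⟨c, fun z => congrFun hc z⟩

lemma theta_zero (τ : ℂ) : theta τ 0 = 0 := by
  have := theta_neg τ 0
  rw [neg_zero] at this
  linear_combination this / 2

lemma theta_mul_of_zero (τ : ℂ) (hτ : 0 < τ.im) (w : ℂ) (hw : theta τ w = 0) :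
    ∃ c : ℂ, c ≠ 0 ∧ ∀ z, theta τ (z + w) * theta τ (z - w) = c * theta τ z ^ 2 := by
  have hT : ∀ z, theta τ z ^ 2 = ta τ z * tb τ 0 - tb τ z * ta τ 0 := fun z => by
    rw [← theta_add_mul τ hτ]; simp [sq]
  obtain ⟨x, hx⟩ := theta_ne_zero τ hτ
  have hd := theta_diff τ hτ
  have hex : ∃ c : ℂ, ∀ z, theta τ (z + w) * theta τ (z - w) = c * theta τ z ^ 2 := by
    have h0 := hT w
    rw [hw] at h0
    by_cases ha : ta τ 0 = 0
    · have hb : tb τ 0 ≠ 0 := by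
        intro hb
        have := hT x
        rw [ha, hb] at this
        simp [hx] at this
      refine ⟨tb τ w / tb τ 0, fun z => ?_⟩
      rw [theta_add_mul τ hτ, hT]
      field_simp
      linear_combination (tb τ z) * h0
    · refine ⟨ta τ w / ta τ 0, fun z => ?_⟩
      rw [theta_add_mul τ hτ, hT]
      field_simp
      linear_combination (ta τ z) * h0
  obtain ⟨c, hc⟩ := hex
  refine ⟨c, ?_, hc⟩
  rintro rfl
  have := entire_mul_zero (f := fun z => theta τ (z + w)) (g := fun z => theta τ (z - w))
    (by fun_prop) (by fun_prop) (fun z => by simpa using hc z) ⟨x + w, by simpa using hx⟩ (x - w)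
  simp at this
  exact hx this

lemma order_shift {f : ℂ → ℂ} (_hf : Differentiable ℂ f) (c z : ℂ) :
    analyticOrderAt (fun x => f (x + c)) z = analyticOrderAt f (z + c) := by
  have := analyticOrderAt_comp_of_deriv_ne_zero (f := f) (g := fun x : ℂ => x + c) (z₀ := z)
    (by fun_prop) (by simp)
  exact this

lemma theta_zero_mem (τ : ℂ) (hτ : 0 < τ.im) (w : ℂ) (hw : theta τ w = 0) : w ∈ Lam τ := by
  obtain ⟨c, hc0, hc⟩ := theta_mul_of_zero τ hτ w hw
  have hd := theta_diff τ hτ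
  have hne := theta_ne_zero τ hτ
  have hfin := entire_order_ne_top hd hne
  have ho : ∀ z, analyticOrderAt (theta τ) (z + w) + analyticOrderAt (theta τ) (z - w) =
      2 * analyticOrderAt (theta τ) z := by
    intro z
    have e : (fun x => theta τ (x + w)) * (fun x => theta τ (x + -w)) =
        (fun _ => c) * theta τ ^ 2 := by
      ext x
      simpa [sub_eq_add_neg] using hc x
    have := congrArg (fun F => analyticOrderAt F z) e
    have d1 : Differentiable ℂ (fun x => theta τ (x + w)) := by fun_prop
    have d2 : Differentiable ℂ (fun x => theta τ (x + -w)) := by fun_prop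
    rw [analyticOrderAt_mul (d1.analyticAt z) (d2.analyticAt z),
      analyticOrderAt_mul analyticAt_const ((hd.analyticAt z).pow 2),
      analyticOrderAt_pow (hd.analyticAt z), order_shift hd, order_shift hd,
      (analyticAt_const.analyticOrderAt_eq_zero).2 hc0] at this
    simpa [sub_eq_add_neg] using this
  have hshift : ∀ z, analyticOrderAt (fun x => theta τ (x + w)) z = analyticOrderAt (theta τ) z := by
    intro z
    rw [order_shift hd]
    have key := int_seq_const (fun n => (analyticOrderAt (theta τ) (z + n * w)).toNat) (fun n => by
      have h := ho (z + n * w)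
      have e1 : z + n * w + w = z + ((n + 1 : ℤ) : ℂ) * w := by push_cast; ring
      have e2 : z + n * w - w = z + ((n - 1 : ℤ) : ℂ) * w := by push_cast; ring
      rw [e1, e2] at h
      rw [← ENat.natCast_toNat (hfin (z + ((n + 1 : ℤ) : ℂ) * w)),
        ← ENat.natCast_toNat (hfin (z + ((n - 1 : ℤ) : ℂ) * w)),
        ← ENat.natCast_toNat (hfin (z + n * w))] at h
      exact_mod_cast h) 0
    simp only [zero_add, Int.cast_one, one_mul, Int.cast_zero, zero_mul, add_zero] at key
    rw [← ENat.natCast_toNat (hfin (z + w)), ← ENat.natCast_toNat (hfin z), key]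
  have d1 : Differentiable ℂ (fun x => theta τ (x + w)) := by fun_prop
  obtain ⟨q, hq, hq0, hqe⟩ := entire_quot d1 hd hne hshift
  have q1 : ∀ z, q (z + 1) = q z := by
    intro z
    have := entire_mul_zero (f := fun z => q (z + 1) - q z) (g := theta τ) (by fun_prop) hd
      (fun z => by
        have a := hqe z
        have b := hqe (z + 1)
        rw [add_right_comm, theta_add_one, theta_add_one] at b
        linear_combination a + b) hne z
    exact sub_eq_zero.1 this
  set κ := cexp (-2 * Real.pi * I * w) with hκ
  have qτ : ∀ z, q (z + τ) = κ * q z := by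
    intro z
    have := entire_mul_zero (f := fun z => q (z + τ) - κ * q z) (g := theta τ) (by fun_prop) hd
      (fun z => by
        have a := hqe z
        have b := hqe (z + τ)
        rw [add_right_comm, theta_add_tau, theta_add_tau] at b
        have e : cexp (-Real.pi * I * (τ + 2 * (z + w))) =
            cexp (-Real.pi * I * (τ + 2 * z)) * κ := by
          rw [hκ, ← Complex.exp_add]; congr 1; ring
        have e0 := Complex.exp_ne_zero (-Real.pi * I * (τ + 2 * z))
        rw [e, a] at b
        apply mul_left_cancel₀ e0
        linear_combination b) hne z
    exact sub_eq_zero.1 this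
  have hdq : Differentiable ℂ (deriv q) := hq.deriv
  obtain ⟨a, ha⟩ := elliptic_const τ hτ (p := fun z => deriv q z / q z)
    (fun z => (hdq z).div (hq z) (hq0 z))
    (fun z => by
      have : deriv q (z + 1) = deriv q z := by
        rw [← deriv_comp_add_const]
        congr 1
        exact funext q1
      simp only [this, q1])
    (fun z => by
      have : deriv q (z + τ) = κ * deriv q z := by
        rw [← deriv_comp_add_const, ← deriv_const_mul κ (hq z)]
        congr 1
        exact funext qτ
      simp only [this, qτ]
      rw [mul_div_mul_left _ _ (Complex.exp_ne_zero _)])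
  have hq' : ∀ z, deriv q z = a * q z := fun z => by
    rw [← ha z]; field_simp [hq0 z]
  have hconst : ∀ z, q z * cexp (-a * z) = q 0 := by
    intro z
    have hD : Differentiable ℂ (fun z => q z * cexp (-a * z)) := by fun_prop
    have := is_const_of_deriv_eq_zero hD (fun x => by
      have h1 : HasDerivAt (fun z => cexp (-a * z)) (cexp (-a * x) * (-a)) x := by
        simpa using ((hasDerivAt_id x).const_mul (-a)).cexp
      have h2 := ((hq x).hasDerivAt.mul h1).deriv
      have h3 : deriv (fun z => q z * cexp (-a * z)) x = _ := h2
      rw [h3, hq']; ring) z 0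
    simpa using this
  have ea : cexp (-a) = 1 := by
    have := hconst 1
    have b := q1 0
    rw [zero_add] at b
    rw [b, mul_one] at this
    exact mul_left_cancel₀ (hq0 0) (by rw [this, mul_one])
  have et : cexp (-2 * Real.pi * I * w - a * τ) = 1 := by
    have := hconst τ
    have b := qτ 0
    rw [zero_add] at b
    rw [b] at this
    apply mul_left_cancel₀ (hq0 0)
    have e : (-2 * Real.pi * I * w - a * τ : ℂ) = (-2 * Real.pi * I * w) + (-a * τ) := by ring
    rw [e, Complex.exp_add, ← hκ]
    linear_combination this
  obtain ⟨m, hm⟩ := Complex.exp_eq_one_iff.1 ea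
  obtain ⟨n, hn⟩ := Complex.exp_eq_one_iff.1 et
  refine ⟨-n, m, ?_⟩
  have hp : (2 * Real.pi * I : ℂ) ≠ 0 := Complex.two_pi_I_ne_zero
  apply mul_left_cancel₀ hp
  push_cast
  linear_combination -hn + τ * hm

lemma ta_diff (τ : ℂ) (hτ : 0 < τ.im) : Differentiable ℂ (ta τ) := by
  have h2 : 0 < (2 * τ).im := by simpa using hτ
  intro z
  exact (differentiableAt_jacobiTheta₂_fst (2 * z) h2).comp z
    (f := fun z : ℂ => 2 * z) (by fun_prop)

lemma tb_diff (τ : ℂ) (hτ : 0 < τ.im) : Differentiable ℂ (tb τ) := by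
  have h2 : 0 < (2 * τ).im := by simpa using hτ
  intro z
  have : DifferentiableAt ℂ (fun z : ℂ => jacobiTheta₂ (2 * z + τ) (2 * τ)) z :=
    (differentiableAt_jacobiTheta₂_fst (2 * z + τ) h2).comp z
      (f := fun z : ℂ => 2 * z + τ) (by fun_prop)
  unfold tb
  fun_prop

lemma theta_H (τ : ℂ) (hτ : 0 < τ.im) (z : ℂ) :
    2 * (theta τ z * deriv (deriv (theta τ)) z - deriv (theta τ) z ^ 2) =
      ta τ z * deriv (deriv (tb τ)) 0 - tb τ z * deriv (deriv (ta τ)) 0 := by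
  have hd := theta_diff τ hτ
  have hd1 : Differentiable ℂ (deriv (theta τ)) := hd.deriv
  have da := ta_diff τ hτ
  have db := tb_diff τ hτ
  have da1 : Differentiable ℂ (deriv (ta τ)) := da.deriv
  have db1 : Differentiable ℂ (deriv (tb τ)) := db.deriv
  have key : (fun u => theta τ (z + u) * theta τ (z - u)) =
      fun u => ta τ z * tb τ u - tb τ z * ta τ u := funext (theta_add_mul τ hτ z)
  have p : ∀ (f : ℂ → ℂ), Differentiable ℂ f → ∀ u, HasDerivAt (fun u => f (z + u))
      (deriv f (z + u)) u := fun f hf u => by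
    simpa using (hf (z + u)).hasDerivAt.comp_const_add z u
  have m : ∀ (f : ℂ → ℂ), Differentiable ℂ f → ∀ u, HasDerivAt (fun u => f (z - u))
      (-deriv f (z - u)) u := fun f hf u => by
    simpa using (hf (z - u)).hasDerivAt.comp_const_sub z u
  have L1 : deriv (fun u => theta τ (z + u) * theta τ (z - u)) = fun u =>
      deriv (theta τ) (z + u) * theta τ (z - u) + theta τ (z + u) * (-deriv (theta τ) (z - u)) :=
    funext fun u => ((p _ hd u).mul (m _ hd u)).deriv
  have R1 : deriv (fun u => ta τ z * tb τ u - tb τ z * ta τ u) = fun u =>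
      ta τ z * deriv (tb τ) u - tb τ z * deriv (ta τ) u :=
    funext fun u => (((db u).hasDerivAt.const_mul _).sub ((da u).hasDerivAt.const_mul _)).deriv
  have L2 := ((((p _ hd1 0).mul (m _ hd 0)).add ((p _ hd 0).mul (m _ hd1 0).neg))).deriv
  have R2 := (((db1 0).hasDerivAt.const_mul (ta τ z)).sub
    ((da1 0).hasDerivAt.const_mul (tb τ z))).deriv
  have E : deriv (deriv (fun u => theta τ (z + u) * theta τ (z - u))) 0 =
    deriv (deriv (fun u => ta τ z * tb τ u - tb τ z * ta τ u)) 0 := by rw [key]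
  rw [L1, R1] at E
  have E' := L2.symm.trans (E.trans R2)
  simp only [add_zero, sub_zero, Pi.neg_apply] at E'
  linear_combination E'

lemma theta_main (τ : ℂ) (hτ : 0 < τ.im) (z u : ℂ) :
    -(deriv (theta τ) 0 ^ 2) * (theta τ (z + u) * theta τ (z - u)) =
      (deriv (theta τ) z ^ 2 - theta τ z * deriv (deriv (theta τ)) z) * theta τ u ^ 2 -
      (deriv (theta τ) u ^ 2 - theta τ u * deriv (deriv (theta τ)) u) * theta τ z ^ 2 := by
  have hT : ∀ z, theta τ z ^ 2 = ta τ z * tb τ 0 - tb τ z * ta τ 0 := fun z => by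
    rw [← theta_add_mul τ hτ]; simp [sq]
  have H := theta_H τ hτ
  have H0 := H 0
  rw [theta_zero] at H0
  have k : ∀ z, deriv (theta τ) z ^ 2 - theta τ z * deriv (deriv (theta τ)) z =
      -(ta τ z * deriv (deriv (tb τ)) 0 - tb τ z * deriv (deriv (ta τ)) 0) / 2 := fun z => by
    linear_combination (-1/2) * H z
  have k0 : deriv (theta τ) 0 ^ 2 =
      -(ta τ 0 * deriv (deriv (tb τ)) 0 - tb τ 0 * deriv (deriv (ta τ)) 0) / 2 := by
    linear_combination (-1/2) * H0
  rw [k, k, hT, hT, k0, theta_add_mul τ hτ]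
  ring

lemma E2_eq (τ : ℂ) (hτ : 0 < τ.im) (z : ℂ) (hz : theta τ z ≠ 0) :
    E2 τ z = (deriv (theta τ) z ^ 2 - theta τ z * deriv (deriv (theta τ)) z) / theta τ z ^ 2 := by
  have hd := theta_diff τ hτ
  have hd1 : Differentiable ℂ (deriv (theta τ)) := hd.deriv
  have := ((hd1 z).hasDerivAt.div (hd z).hasDerivAt hz).deriv
  have h2 : deriv (E1 τ) z = _ := this
  rw [E2, h2]
  ring

/-- φ(z,u)·φ(z,−u) = E₂(z) − E₂(u), and consequently
φ(z,u)·φ(z,−u) = ℘(z) − ℘(u). -/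
theorem kronecker_product_wp (τ : ℂ) (hτ : 0 < τ.im) (z u : ℂ)
    (hz : z ∉ Lam τ) (hu : u ∉ Lam τ) (hzu : z + u ∉ Lam τ) (hzu' : z - u ∉ Lam τ) :
    phi τ z u * phi τ z (-u) = E2 τ z - E2 τ u ∧
      phi τ z u * phi τ z (-u) = wp τ z - wp τ u := by
  have hz0 : theta τ z ≠ 0 := fun h => hz (theta_zero_mem τ hτ z h)
  have hu0 : theta τ u ≠ 0 := fun h => hu (theta_zero_mem τ hτ u h)
  have key : phi τ z u * phi τ z (-u) = E2 τ z - E2 τ u := by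
    rw [E2_eq τ hτ z hz0, E2_eq τ hτ u hu0, div_sub_div _ _ (pow_ne_zero 2 hz0) (pow_ne_zero 2 hu0)]
    unfold phi
    rw [theta_neg, ← sub_eq_add_neg]
    have := theta_main τ hτ z u
    field_simp
    linear_combination this
  refine ⟨key, ?_⟩
  rw [key]
  unfold wp
  ring

end
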